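/- The critical exponent of the infinite word k equals (2√3 + 12)/3; that is, the supremum, over all nonempty finite factors w of k, of |w|/p(w), where p(w) is the shortest period of w, equals (2√3 + 12)/3 ≈ 5.1547. -/

import Mathlib

/-- The substitution `h` with `h(1) = 110` and `h(0) = 11`. -/
def hsub : ℕ → List ℕ
  | 0 => [1, 1]
  | 1 => [1, 1, 0]
  | _ => []

/-- `h` extended to words by concatenation. -/
def happ (w : List ℕ) : List ℕ := w.flatMap hsub

/-- `K n = h^n(1)`. -/
def Kword (n : ℕ) : List ℕ := happ^[n] [1]

/-- `w` is a factor of the infinite word `k` (indexed from 1). -/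
def IsFactor (k : ℕ → ℕ) (w : List ℕ) : Prop :=
  ∃ i : ℕ, 1 ≤ i ∧ ∀ j : ℕ, j < w.length → w.getD j 0 = k (i + j)

/-- `p` is a period of the finite word `w`: `1 ≤ p ≤ |w|` and `w[j] = w[j+p]`
whenever both indices are in range. -/
def IsPeriod (w : List ℕ) (p : ℕ) : Prop :=
  1 ≤ p ∧ p ≤ w.length ∧ ∀ j : ℕ, j + p < w.length → w.getD j 0 = w.getD (j + p) 0

/-- The shortest period of `w`. -/
noncomputable def leastPeriod (w : List ℕ) : ℕ := sInf {p : ℕ | IsPeriod w p}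

/-- `pz m = (|h^m(1)|, |h^m(0)|)`. -/
def pz : ℕ → ℕ × ℕ
  | 0 => (1, 1)
  | m + 1 => (2 * (pz m).1 + (pz m).2, 2 * (pz m).1)

/-- accumulated overhang -/
def gg : ℕ → ℕ
  | 0 => 0
  | m + 1 => gg m + 2 * (pz m).1

/-- weight of a letter -/
def FF (m c : ℕ) : ℕ := if c = 1 then (pz m).1 else (pz m).2

/-- weight of a prefix -/
def SS (κ : ℕ → ℕ) (m : ℕ) : ℕ → ℕ
  | 0 => 0
  | x + 1 => SS κ m x + FF m (κ x)

/-- structural properties of a fixed point -/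
structure Good (κ : ℕ → ℕ) : Prop where
  bin : ∀ x, κ x = 0 ∨ κ x = 1
  b0 : ∀ x, κ (SS κ 1 x) = 1
  b1 : ∀ x, κ (SS κ 1 x + 1) = 1
  b2 : ∀ x, κ x = 1 → κ (SS κ 1 x + 2) = 0

theorem pz_pos (m : ℕ) : 1 ≤ (pz m).1 ∧ 1 ≤ (pz m).2 := by
  induction m with
  | zero => simp [pz]
  | succ m ih => simp only [pz]; omega

theorem pz_le (m : ℕ) : (pz m).2 ≤ (pz m).1 := by
  cases m with
  | zero => simp [pz]
  | succ m => simp only [pz]; omega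

theorem pz_ge (m : ℕ) : 2 * (pz m).1 ≤ 3 * (pz m).2 := by
  cases m with
  | zero => simp [pz]
  | succ m => have := pz_le m; simp only [pz]; omega

theorem pz_big (m : ℕ) : m + 1 ≤ (pz m).1 := by
  induction m with
  | zero => simp [pz]
  | succ m ih => simp only [pz]; omega

theorem gg_eq (m : ℕ) : 3 * gg m + 4 = 2 * ((pz m).1 + (pz m).2) := by
  induction m with
  | zero => simp [pz, gg]
  | succ m ih => simp only [pz, gg]; omega

theorem err_bound (m : ℕ) :
    |((pz m).2 : ℝ) - (√3 - 1) * (pz m).1| ≤ 1 := by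
  have h3 : √3 * √3 = 3 := Real.mul_self_sqrt (by norm_num)
  have hl : 1 ≤ √3 := by nlinarith [Real.sqrt_nonneg 3]
  have hu : √3 ≤ 2 := by nlinarith [Real.sqrt_nonneg 3]
  induction m with
  | zero => simp only [pz]; rw [abs_le]; constructor <;> push_cast <;> linarith
  | succ m ih =>
    have e : (((pz (m+1)).2 : ℝ) - (√3 - 1) * (pz (m+1)).1)
        = -(√3 - 1) * (((pz m).2 : ℝ) - (√3 - 1) * (pz m).1) := by
      simp only [pz]; push_cast; linear_combination (-(pz m).1 : ℝ) * h3
    rw [e, abs_mul, abs_neg, abs_of_nonneg (by linarith : 0 ≤ √3 - 1)]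
    have := abs_nonneg (((pz m).2 : ℝ) - (√3 - 1) * (pz m).1)
    nlinarith

theorem gg_bounds (m : ℕ) : (gg m : ℝ) ≤ (2 * √3 / 3) * (pz m).1 ∧
    (2 * √3 / 3) * (pz m).1 - 2 ≤ (gg m : ℝ) := by
  have h := err_bound m
  rw [abs_le] at h
  have e : (3 * gg m + 4 : ℝ) = 2 * ((pz m).1 + (pz m).2) := by exact_mod_cast gg_eq m
  constructor <;> nlinarith

section
variable {κ : ℕ → ℕ}

theorem FF_le (m c : ℕ) : FF m c ≤ (pz m).1 := by
  unfold FF; split_ifs; exacts [le_rfl, pz_le m]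

theorem FF_ge (m c : ℕ) : (pz m).2 ≤ FF m c := by
  unfold FF; split_ifs; exacts [pz_le m, le_rfl]

theorem SS_zero_eq (x : ℕ) : SS κ 0 x = x := by
  induction x with
  | zero => rfl
  | succ x ih => simp [SS, ih, FF, pz]

theorem SS_mono (m : ℕ) : Monotone (SS κ m) :=
  monotone_nat_of_le_succ fun x => by simp [SS]

theorem SS_one_strict : StrictMono (SS κ 1) :=
  strictMono_nat_of_lt_succ fun x => by
    have := FF_ge 1 (κ x); have := pz_pos 1; simp only [SS]; omega

theorem SS_add_le (m x l : ℕ) : SS κ m (x + l) ≤ SS κ m x + l * (pz m).1 := by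
  induction l with
  | zero => simp
  | succ l ih =>
    have := FF_le m (κ (x + l))
    rw [← Nat.add_assoc]; simp only [SS]; rw [Nat.succ_mul]; omega

theorem SS_one_succ_of_one {x : ℕ} (h : κ x = 1) : SS κ 1 (x + 1) = SS κ 1 x + 3 := by
  simp [SS, FF, pz, h]

theorem SS_one_succ_of_zero {x : ℕ} (h : κ x = 0) : SS κ 1 (x + 1) = SS κ 1 x + 2 := by
  simp [SS, FF, pz, h]

theorem Good.comp (G : Good κ) (m x : ℕ) : SS κ m (SS κ 1 x) = SS κ (m + 1) x := by
  induction x with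
  | zero => rfl
  | succ x ih =>
    have e0 := G.b0 x
    have e1 := G.b1 x
    rcases G.bin x with h | h
    · rw [SS_one_succ_of_zero h]
      simp [SS, ih, FF, pz, h, e0, e1]; omega
    · rw [SS_one_succ_of_one h]
      have e2 := G.b2 x h
      simp [SS, ih, FF, pz, h, e0, e1, e2]; omega

theorem Good.b2' (G : Good κ) {x : ℕ} (h : κ x = 0) :
    κ (SS κ 1 x + 2) = 1 ∧ κ (SS κ 1 x + 3) = 1 := by
  have a := G.b0 (x + 1)
  have b := G.b1 (x + 1)
  rw [SS_one_succ_of_zero h] at a b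
  exact ⟨a, b⟩

theorem Good.cover (G : Good κ) (c : ℕ) : ∃ x, c = SS κ 1 x ∨ c = SS κ 1 x + 1 ∨
    (c = SS κ 1 x + 2 ∧ κ x = 1) := by
  induction c with
  | zero => exact ⟨0, Or.inl rfl⟩
  | succ c ih =>
    obtain ⟨x, h | h | ⟨h, h'⟩⟩ := ih
    · exact ⟨x, by omega⟩
    · rcases G.bin x with e | e
      · exact ⟨x + 1, by rw [SS_one_succ_of_zero e]; omega⟩
      · exact ⟨x, by omega⟩
    · exact ⟨x + 1, by rw [SS_one_succ_of_one h']; omega⟩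

theorem Good.no00 (G : Good κ) {x : ℕ} (h : κ x = 0) : κ (x + 1) = 1 := by
  obtain ⟨y, e | e | ⟨e, e'⟩⟩ := G.cover x
  · have := G.b0 y; rw [← e] at this; omega
  · have := G.b1 y; rw [← e] at this; omega
  · have := G.b0 (y + 1); rw [SS_one_succ_of_one e'] at this; rw [e]; exact this

theorem Good.fiveOnes (G : Good κ) (x : ℕ) : ¬ (κ x = 1 ∧ κ (x + 1) = 1 ∧ κ (x + 2) = 1 ∧
    κ (x + 3) = 1 ∧ κ (x + 4) = 1) := by
  rintro ⟨h0, h1, h2, h3, h4⟩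
  obtain ⟨y, e | e | ⟨e, e'⟩⟩ := G.cover x
  all_goals subst e
  · rcases G.bin y with e | e
    · have := G.b2 (y + 1) (G.no00 e)
      rw [SS_one_succ_of_zero e] at this
      simp only [Nat.add_assoc, Nat.reduceAdd] at this
      omega
    · have := G.b2 y e; omega
  · rcases G.bin y with e | e
    · have := G.b2 (y + 1) (G.no00 e)
      rw [SS_one_succ_of_zero e] at this
      simp only [Nat.add_assoc] at *
      simp at *; omega
    · have := G.b2 y e
      simp only [Nat.add_assoc] at *
      simp at *; omega
  · have := G.b2 y e'; omega

/-- recognizability: block starts are detected by a window of length 4 -/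
theorem Good.bdry (G : Good κ) (c : ℕ) : (∃ x, c = SS κ 1 x) ↔
    (κ c = 1 ∧ κ (c + 1) = 1 ∧ ¬ (κ (c + 2) = 1 ∧ κ (c + 3) = 0)) := by
  constructor
  · rintro ⟨x, rfl⟩
    refine ⟨G.b0 x, G.b1 x, ?_⟩
    rcases G.bin x with e | e
    · have := G.b2' e; omega
    · have := G.b2 x e; omega
  · rintro ⟨h0, h1, h2⟩
    obtain ⟨y, e | e | ⟨e, e'⟩⟩ := G.cover c
    · exact ⟨y, e⟩
    · exfalso
      subst e
      rcases G.bin y with e | e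
      · have a := G.b2 (y + 1) (G.no00 e)
        have b := G.b1 (y + 1)
        rw [SS_one_succ_of_zero e] at a b
        exact h2 ⟨b, a⟩
      · have := G.b2 y e
        simp only [Nat.add_assoc] at *
        simp at *; omega
    · subst e; have := G.b2 y e'; omega

theorem Good.desub (G : Good κ) {i p l : ℕ} (hp : 1 ≤ p) (hl : 6 ≤ l)
    (h : ∀ x, i ≤ x → x < i + l → κ x = κ (x + p)) :
    ∃ a q l', 1 ≤ q ∧ q < p ∧ SS κ 1 (a + q) = SS κ 1 a + p ∧ SS κ 1 a ≤ i ∧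
      i + l ≤ SS κ 1 (a + l') + 2 ∧
      (∀ x, SS κ 1 a ≤ x → x < i + l → κ x = κ (x + p)) ∧
      (∀ t, a ≤ t → t < a + l' → κ t = κ (t + q)) := by
  -- starting data
  have key : ∃ a b, SS κ 1 b = SS κ 1 a + p ∧ SS κ 1 a ≤ i ∧
      (∀ x, SS κ 1 a ≤ x → x < i + l → κ x = κ (x + p)) := by
    have shift : ∀ c, i ≤ c → c ≤ i + 2 → (∃ x, c = SS κ 1 x) → ∃ y, c + p = SS κ 1 y := by
      intro c h1 h2 h3
      rw [G.bdry] at h3 ⊢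
      have e0 := h c (by omega) (by omega)
      have e1 := h (c + 1) (by omega) (by omega)
      have e2 := h (c + 2) (by omega) (by omega)
      have e3 := h (c + 3) (by omega) (by omega)
      rw [show c + p + 1 = c + 1 + p by omega, show c + p + 2 = c + 2 + p by omega,
        show c + p + 3 = c + 3 + p by omega, ← e0, ← e1, ← e2, ← e3]
      exact h3
    obtain ⟨a, ha⟩ := G.cover i
    by_cases hi : i = SS κ 1 a
    · obtain ⟨b, hb⟩ := shift i le_rfl (by omega) ⟨a, hi⟩
      exact ⟨a, b, by omega, by omega, fun x hx => h x (by omega)⟩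
    -- next boundary
    have hn : i < SS κ 1 (a + 1) ∧ SS κ 1 (a + 1) ≤ i + 2 := by
      rcases G.bin a with e | e
      · rw [SS_one_succ_of_zero e]; omega
      · rw [SS_one_succ_of_one e]; omega
    obtain ⟨b', hb⟩ := shift _ hn.1.le hn.2 ⟨a + 1, rfl⟩
    obtain ⟨b, rfl⟩ : ∃ b, b' = b + 1 := by
      cases b' with
      | zero => simp only [SS] at hb; omega
      | succ b => exact ⟨b, rfl⟩
    have hlast := h (SS κ 1 (a + 1) - 1) (by omega) (by omega)
    have hlast' : κ (SS κ 1 (a + 1) - 1) = κ (SS κ 1 (b + 1) - 1) := by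
      rw [hlast]; congr 1; omega
    have a0 := G.b0 a
    have a1 := G.b1 a
    have b0 := G.b0 b
    have b1 := G.b1 b
    rcases G.bin a with ea | ea <;> rcases G.bin b with eb | eb
    · rw [SS_one_succ_of_zero ea] at *
      rw [SS_one_succ_of_zero eb] at *
      refine ⟨a, b, by omega, by omega, fun x hx hx' => ?_⟩
      rcases Nat.lt_or_ge x i with hlt | hge
      · obtain rfl : x = SS κ 1 a := by omega
        rw [show SS κ 1 a + p = SS κ 1 b by omega, a0, b0]
      · exact h x hge hx'
    · exfalso
      have := G.b2 b eb
      rw [SS_one_succ_of_zero ea, SS_one_succ_of_one eb] at hlast'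
      simp at hlast'; omega
    · exfalso
      have := G.b2 a ea
      rw [SS_one_succ_of_one ea, SS_one_succ_of_zero eb] at hlast'
      simp at hlast'; omega
    · rw [SS_one_succ_of_one ea] at *
      rw [SS_one_succ_of_one eb] at *
      refine ⟨a, b, by omega, by omega, fun x hx hx' => ?_⟩
      rcases Nat.lt_or_ge x i with hlt | hge
      · rcases (by omega : x = SS κ 1 a ∨ x = SS κ 1 a + 1) with rfl | rfl
        · rw [show SS κ 1 a + p = SS κ 1 b by omega, a0, b0]
        · rw [show SS κ 1 a + 1 + p = SS κ 1 b + 1 by omega, a1, b1]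
      · exact h x hge hx'
  obtain ⟨a, b, hab, hai, hag⟩ := key
  have hlt : a < b := SS_one_strict.lt_iff_lt.1 (by omega : SS κ 1 a < SS κ 1 b)
  obtain ⟨q, rfl⟩ : ∃ q, b = a + q := ⟨b - a, by omega⟩
  have hex : ∃ l', i + l ≤ SS κ 1 (a + l') + 2 := by
    refine ⟨i + l, ?_⟩
    have := (SS_one_strict (κ := κ)).le_apply (x := a + (i + l))
    omega
  classical
  let l' := Nat.find hex
  have hl' : i + l ≤ SS κ 1 (a + l') + 2 := Nat.find_spec hex
  have hmin : ∀ t, t < l' → SS κ 1 (a + t) + 2 < i + l := fun t ht => by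
    have := Nat.find_min hex ht; omega
  have ind : ∀ t, t ≤ l' → SS κ 1 (a + q + t) = SS κ 1 (a + t) + p ∧
      ∀ s, s < t → κ (a + s) = κ (a + q + s) := by
    intro t
    induction t with
    | zero => intro _; exact ⟨hab, by simp⟩
    | succ t ih =>
      intro ht
      obtain ⟨i1, i2⟩ := ih (by omega)
      have hm := hmin t (by omega)
      have hge : SS κ 1 a ≤ SS κ 1 (a + t) := SS_mono 1 (by omega)
      have hx := hag (SS κ 1 (a + t) + 2) (by omega) hm
      rw [show SS κ 1 (a + t) + 2 + p = SS κ 1 (a + q + t) + 2 by omega] at hx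
      have eq : κ (a + t) = κ (a + q + t) := by
        rcases G.bin (a + t) with e | e <;> rcases G.bin (a + q + t) with e' | e'
        · rw [e, e']
        · have := G.b2' e; have := G.b2 _ e'; omega
        · have := G.b2' e'; have := G.b2 _ e; omega
        · rw [e, e']
      refine ⟨?_, ?_⟩
      · rw [← Nat.add_assoc, ← Nat.add_assoc]; simp only [SS]; rw [i1, eq]; omega
      · intro s hs
        rcases Nat.lt_succ_iff_lt_or_eq.1 hs with hs | rfl
        · exact i2 s hs
        · exact eq
  have hqp : q < p := by
    have : ∀ q, 2 * q + SS κ 1 a ≤ SS κ 1 (a + q) := by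
      intro q
      induction q with
      | zero => simp
      | succ q ih =>
        have := FF_ge 1 (κ (a + q))
        have e : (pz 1).2 = 2 := rfl
        rw [← Nat.add_assoc]; simp only [SS]; omega
    have := this q
    omega
  refine ⟨a, q, l', by omega, hqp, hab, hai, hl', hag, fun t h1 h2 => ?_⟩
  have := (ind l' le_rfl).2 (t - a) (by omega)
  rw [show a + (t - a) = t by omega, show a + q + (t - a) = t + q by omega] at this
  exact this

theorem SS_conj {p x0 : ℕ} (m l : ℕ) (h : ∀ x, x0 ≤ x → x < x0 + l → κ x = κ (x + p)) :
    SS κ m (x0 + l + p) + SS κ m x0 = SS κ m (x0 + p) + SS κ m (x0 + l) := by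
  induction l with
  | zero => simp [Nat.add_comm]
  | succ l ih =>
    have h1 := ih fun x hx hx' => h x hx (by omega)
    have h2 := h (x0 + l) (by omega) (by omega)
    rw [show x0 + (l + 1) + p = x0 + l + p + 1 by omega, ← Nat.add_assoc]
    simp only [SS]; rw [h2]; omega

theorem Good.main (G : Good κ) (p : ℕ) : ∀ m i l : ℕ, 1 ≤ p →
    (∀ x, i ≤ x → x < i + l → κ x = κ (x + p)) →
    (SS κ m (i + l) : ℝ) - SS κ m i + gg m ≤
      (3 + 2 * √3 / 3) * ((SS κ m (i + p) : ℝ) - SS κ m i) := by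
  induction p using Nat.strong_induction_on with
  | _ p ih =>
  intro m i l hp h
  have h3 : √3 * √3 = 3 := Real.mul_self_sqrt (by norm_num)
  have hl : 1 ≤ √3 := by nlinarith [Real.sqrt_nonneg 3]
  have hu : √3 ≤ 2 := by nlinarith [Real.sqrt_nonneg 3]
  rcases Nat.lt_or_ge l 6 with h6 | h6
  · -- base case
    have hg := (gg_bounds m).1
    have hz : (2 * (pz m).1 : ℝ) ≤ 3 * (pz m).2 := by exact_mod_cast pz_ge m
    have hpp : (1 : ℝ) ≤ (pz m).1 := by exact_mod_cast (pz_pos m).1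
    have hle : (SS κ m (i + l) : ℝ) ≤ SS κ m i + l * (pz m).1 := by
      exact_mod_cast SS_add_le m i l
    rcases Nat.lt_or_ge p 2 with h2 | h2
    · obtain rfl : p = 1 := by omega
      have e1 : (SS κ m (i + 1) : ℝ) = SS κ m i + FF m (κ i) := by simp [SS]
      rcases Nat.eq_zero_or_pos l with rfl | hl0
      · have : ((pz m).2 : ℝ) ≤ FF m (κ i) := by exact_mod_cast FF_ge m (κ i)
        rw [e1]
        simp only [Nat.add_zero] 
        nlinarith
      · have a0 := h i (by omega) (by omega)
        have k0 : κ i = 1 := by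
          rcases G.bin i with e | e
          · have := G.no00 e; omega
          · exact e
        have hl3 : l ≤ 3 := by
          by_contra hc
          have a1 := h (i + 1) (by omega) (by omega)
          have a2 := h (i + 2) (by omega) (by omega)
          have a3 := h (i + 3) (by omega) (by omega)
          simp only [Nat.add_assoc, Nat.reduceAdd] at a1 a2 a3
          exact G.fiveOnes i ⟨k0, by omega, by omega, by omega, by omega⟩
        have hl3' : (l : ℝ) ≤ 3 := by exact_mod_cast hl3
        have : FF m (κ i) = (pz m).1 := by simp [FF, k0]
        rw [e1, this]
        nlinarith
    · have hl5 : (l : ℝ) ≤ 5 := by exact_mod_cast (by omega : l ≤ 5)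
      have hs : SS κ m i + ((pz m).1 + (pz m).2) ≤ SS κ m (i + p) := by
        have h1 : SS κ m (i + 2) ≤ SS κ m (i + p) := SS_mono m (by omega)
        have h4 : SS κ m (i + 2) = SS κ m i + FF m (κ i) + FF m (κ (i + 1)) := rfl
        rcases G.bin i with e | e
        · have e' := G.no00 e
          simp [FF, e, e'] at h4; omega
        · have := FF_ge m (κ (i + 1))
          have : FF m (κ i) = (pz m).1 := by simp [FF, e]
          omega
      have hs' : (SS κ m i : ℝ) + ((pz m).1 + (pz m).2) ≤ SS κ m (i + p) := by
        exact_mod_cast hs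
      have hd : (5 / 3 * (pz m).1 : ℝ) ≤ SS κ m (i + p) - SS κ m i := by linarith
      have := mul_le_mul_of_nonneg_left hd (by positivity : 0 ≤ 3 + 2 * √3 / 3)
      nlinarith
  · obtain ⟨a, q, l', hq, hqp, hab, hai, hil, hag, hag'⟩ := G.desub hp h6 h
    have IH := ih q hqp (m + 1) a l' hq hag'
    rw [← G.comp m, ← G.comp m, ← G.comp m, hab] at IH
    have c := SS_conj (κ := κ) (p := p) (x0 := SS κ 1 a) m (i - SS κ 1 a)
      (fun x hx hx' => hag x hx (by omega))
    rw [show SS κ 1 a + (i - SS κ 1 a) = i by omega] at c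
    have c' : (SS κ m (i + p) : ℝ) + SS κ m (SS κ 1 a) =
      SS κ m (SS κ 1 a + p) + SS κ m i := by exact_mod_cast c
    have d1 : SS κ m (i + l) ≤ SS κ m (SS κ 1 (a + l')) + 2 * (pz m).1 :=
      (SS_mono m hil).trans (SS_add_le m _ 2)
    have d1' : (SS κ m (i + l) : ℝ) ≤ SS κ m (SS κ 1 (a + l')) + 2 * (pz m).1 := by
      exact_mod_cast d1
    have d2 : (SS κ m (SS κ 1 a) : ℝ) ≤ SS κ m i := by exact_mod_cast SS_mono m hai
    have d3 : (gg (m + 1) : ℝ) = gg m + 2 * (pz m).1 := by simp [gg]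
    rw [show (SS κ m (i + p) : ℝ) - SS κ m i
      = SS κ m (SS κ 1 a + p) - SS κ m (SS κ 1 a) by linarith]
    linarith

/-- pushing a repetition forward -/
theorem Good.push (G : Good κ) {a q l : ℕ} (h : ∀ t, t < l → κ (a + t) = κ (a + q + t)) :
    ∀ t, t < SS κ 1 (a + l) + 2 - SS κ 1 a → κ (SS κ 1 a + t) = κ (SS κ 1 (a + q) + t) := by
  induction l with
  | zero =>
    intro t ht
    simp only [Nat.add_zero] at ht
    rcases (by omega : t = 0 ∨ t = 1) with rfl | rfl
    · exact (G.b0 _).trans (G.b0 _).symm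
    · exact (G.b1 _).trans (G.b1 _).symm
  | succ l ih =>
    have ih := ih fun t ht => h t (by omega)
    have al : ∀ s, s ≤ l + 1 → SS κ 1 (a + q + s) + SS κ 1 a = SS κ 1 (a + s) + SS κ 1 (a + q) := by
      intro s
      induction s with
      | zero => simp [Nat.add_comm]
      | succ s ihs =>
        intro hs
        have := ihs (by omega)
        rw [← Nat.add_assoc, ← Nat.add_assoc]; simp only [SS]; rw [h s (by omega)]; omega
    intro t ht
    have hmo : SS κ 1 a ≤ SS κ 1 (a + l) := SS_mono 1 (by omega)
    rcases Nat.lt_or_ge t (SS κ 1 (a + l) + 2 - SS κ 1 a) with h1 | h1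
    · exact ih t h1
    have e := h l (by omega)
    have al0 := al l (by omega)
    have al1 := al (l + 1) le_rfl
    have c0 := G.b0 (a + (l + 1))
    have c1 := G.b1 (a + (l + 1))
    have d0 := G.b0 (a + q + (l + 1))
    have d1 := G.b1 (a + q + (l + 1))
    have hcases : (t = SS κ 1 (a + l) + 2 - SS κ 1 a ∧ κ (a + l) = 1) ∨
        t = SS κ 1 (a + (l + 1)) - SS κ 1 a ∨ t = SS κ 1 (a + (l + 1)) + 1 - SS κ 1 a := by
      rcases G.bin (a + l) with e1 | e1
      · have := SS_one_succ_of_zero e1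
        rw [← Nat.add_assoc] at *; omega
      · have := SS_one_succ_of_one e1
        rw [← Nat.add_assoc] at *; omega
    have hmo' : SS κ 1 a ≤ SS κ 1 (a + (l + 1)) := SS_mono 1 (by omega)
    rcases hcases with ⟨h2, h3⟩ | h2 | h2
    · have f := G.b2 _ h3
      have f' := G.b2 _ (e ▸ h3)
      rw [show SS κ 1 a + t = SS κ 1 (a + l) + 2 by omega,
        show SS κ 1 (a + q) + t = SS κ 1 (a + q + l) + 2 by omega, f, f']
    · rw [show SS κ 1 a + t = SS κ 1 (a + (l + 1)) by omega,
        show SS κ 1 (a + q) + t = SS κ 1 (a + q + (l + 1)) by omega, c0, d0]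
    · rw [show SS κ 1 a + t = SS κ 1 (a + (l + 1)) + 1 by omega,
        show SS κ 1 (a + q) + t = SS κ 1 (a + q + (l + 1)) + 1 by omega, c1, d1]

theorem Good.seedOnes (G : Good κ) : ∃ a, κ a = 1 ∧ κ (a + 1) = 1 ∧ κ (a + 2) = 1 ∧ κ (a + 3) = 1 := by
  have h0 : κ 0 = 1 := G.b0 0
  have h2 : κ 2 = 0 := G.b2 0 h0
  exact ⟨SS κ 1 2, G.b0 2, G.b1 2, (G.b2' h2).1, (G.b2' h2).2⟩

theorem Good.lower (G : Good κ) (m : ℕ) : ∃ a q l, (∀ t, t < l → κ (a + t) = κ (a + q + t)) ∧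
    ∀ j, SS κ j (a + q) = SS κ j a + (pz (j + m)).1 ∧
      SS κ j (a + l) + gg j = SS κ j a + 3 * (pz (j + m)).1 + gg (j + m) := by
  induction m with
  | zero =>
    obtain ⟨a, h0, h1, h2, h3⟩ := G.seedOnes
    refine ⟨a, 1, 3, ?_, ?_⟩
    · intro t ht
      interval_cases t
      · simp [h0, h1]
      · simp [h1, h2]
      · simp [h2, h3]
    · intro j
      constructor
      · simp [SS, FF, h0]
      · simp [SS, FF, h0, h1, h2]; omega
  | succ m ih =>
    obtain ⟨a, q, l, hag, hj⟩ := ih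
    have m1 : SS κ 1 a ≤ SS κ 1 (a + q) := SS_mono 1 (by omega)
    have m2 : SS κ 1 a ≤ SS κ 1 (a + l) := SS_mono 1 (by omega)
    refine ⟨SS κ 1 a, SS κ 1 (a + q) - SS κ 1 a, SS κ 1 (a + l) + 2 - SS κ 1 a, ?_, ?_⟩
    · rw [show SS κ 1 a + (SS κ 1 (a + q) - SS κ 1 a) = SS κ 1 (a + q) by omega]
      exact G.push hag
    · intro j
      obtain ⟨u1, u2⟩ := hj (j + 1)
      rw [show SS κ 1 a + (SS κ 1 (a + q) - SS κ 1 a) = SS κ 1 (a + q) by omega,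
        show SS κ 1 a + (SS κ 1 (a + l) + 2 - SS κ 1 a) = SS κ 1 (a + l) + 1 + 1 by omega]
      simp only [SS]
      rw [G.comp, G.comp, G.comp, show j + (m + 1) = j + 1 + m by omega]
      simp only [gg] at u2
      have f0 : FF j (κ (SS κ 1 (a + l))) = (pz j).1 := by simp [FF, G.b0]
      have f1 : FF j (κ (SS κ 1 (a + l) + 1)) = (pz j).1 := by simp [FF, G.b1]
      exact ⟨u1, by omega⟩

end

theorem Kword_succ (m : ℕ) : Kword (m + 1) = happ (Kword m) := by
  simp [Kword, Function.iterate_succ_apply']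

theorem Kword_bin (m : ℕ) : ∀ c ∈ Kword m, c = 0 ∨ c = 1 := by
  induction m with
  | zero => simp [Kword]
  | succ m ih =>
    intro c hc
    rw [Kword_succ, happ, List.mem_flatMap] at hc
    obtain ⟨d, hd, hc⟩ := hc
    rcases ih d hd with rfl | rfl <;> simp [hsub] at hc <;> omega

theorem happ_len (w : List ℕ) (hw : ∀ c ∈ w, c = 0 ∨ c = 1) : 2 * w.length ≤ (happ w).length := by
  induction w with
  | nil => simp
  | cons c w ih =>
    have := ih fun d hd => hw d (by simp [hd])
    have hc := hw c (by simp)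
    simp only [happ, List.flatMap_cons, List.length_append, List.length_cons] at *
    have e0 : (hsub 0).length = 2 := rfl
    have e1 : (hsub 1).length = 3 := rfl
    rcases hc with rfl | rfl <;> omega

theorem Kword_len (m : ℕ) : m + 1 ≤ (Kword m).length := by
  induction m with
  | zero => simp [Kword]
  | succ m ih => have := happ_len _ (Kword_bin m); rw [Kword_succ]; omega

theorem good_of (k : ℕ → ℕ)
    (hk : ∀ (m i : ℕ), i < (Kword m).length → k (i + 1) = (Kword m).getD i 0) :
    Good (fun x => k (x + 1)) := by
  set κ : ℕ → ℕ := fun x => k (x + 1) with hκ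
  have hget : ∀ m i (h : i < (Kword m).length), κ i = (Kword m)[i] := by
    intro m i h
    have := hk m i h
    rw [List.getD_eq_getElem _ _ h] at this
    exact this
  have bin : ∀ x, κ x = 0 ∨ κ x = 1 := by
    intro x
    have h := Kword_len x
    rw [hget x x (by omega)]
    exact Kword_bin x _ (List.getElem_mem _)
  have pre : ∀ m x, x ≤ (Kword m).length → (List.range x).map κ = (Kword m).take x := by
    intro m x hx
    apply List.ext_getElem
    · simp [hx]
    · intro i h1 h2
      simp at h1
      simp [hget m i (by omega)]
  have len : ∀ x, (happ ((List.range x).map κ)).length = SS κ 1 x := by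
    intro x
    induction x with
    | zero => rfl
    | succ x ih =>
      simp only [happ, List.range_succ, List.map_append, List.flatMap_append, List.length_append,
        SS] at *
      rw [ih]
      rcases bin x with e | e <;> simp [e, hsub, FF, pz]
  have blk : ∀ x j (h : j < (hsub (κ x)).length), κ (SS κ 1 x + j) = (hsub (κ x))[j] := by
    intro x j h
    have hl := Kword_len x
    have hK : Kword (x + 1) = happ ((List.range x).map κ) ++ (hsub (κ x) ++
        happ ((Kword x).drop (x + 1))) := by
      rw [Kword_succ]
      conv_lhs => rw [← List.take_append_drop (x + 1) (Kword x), ← pre x (x + 1) (by omega)]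
      simp [happ, List.range_succ, List.append_assoc]
    have hlen : SS κ 1 x + j < (Kword (x + 1)).length := by
      rw [hK, List.length_append, List.length_append, len]; omega
    rw [hget (x + 1) _ hlen]
    simp only [hK]
    rw [List.getElem_append_right (by rw [len]; omega)]
    simp only [len, Nat.add_sub_cancel_left]
    rw [List.getElem_append_left h]
  have blk' : ∀ x j, j < (hsub (κ x)).length → κ (SS κ 1 x + j) = (hsub (κ x)).getD j 0 := by
    intro x j h
    rw [blk x j h, List.getD_eq_getElem _ _ h]
  refine ⟨bin, ?_, ?_, ?_⟩
  · intro x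
    have := blk' x 0
    rcases bin x with e | e <;> rw [e] at this <;> simpa [hsub] using this
  · intro x
    have := blk' x 1
    rcases bin x with e | e <;> rw [e] at this <;> simpa [hsub] using this
  · intro x e
    have := blk' x 2
    rw [e] at this; simpa [hsub] using this

theorem leastPeriod_mem (w : List ℕ) (hw : w ≠ []) : IsPeriod w (leastPeriod w) := by
  have : (leastPeriod w) ∈ {p : ℕ | IsPeriod w p} := by
    apply Nat.sInf_mem
    refine ⟨w.length, ?_, le_rfl, ?_⟩
    · exact List.length_pos_iff.2 hw
    · intro j hj; omega
  exact this

/-- The critical exponent of the fixed point `k` of `h` — the supremum, in the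
extended reals, of `|w| / p(w)` over nonempty factors `w` of `k`, where `p(w)` is
the shortest period of `w` — equals `(2√3 + 12)/3`. -/
theorem critical_exponent
    (k : ℕ → ℕ)
    (hk : ∀ (m i : ℕ), i < (Kword m).length → k (i + 1) = (Kword m).getD i 0) :
    sSup {x : EReal | ∃ w : List ℕ, w ≠ [] ∧ IsFactor k w ∧
        x = (((w.length : ℝ) / (leastPeriod w : ℝ) : ℝ) : EReal)}
      = (((2 * Real.sqrt 3 + 12) / 3 : ℝ) : EReal) := by
  have G := good_of k hk
  set κ : ℕ → ℕ := fun x => k (x + 1) with hκ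
  apply le_antisymm
  · apply sSup_le
    rintro x ⟨w, hw, ⟨i, hi, hf⟩, rfl⟩
    obtain ⟨hp1, hp2, hp3⟩ := leastPeriod_mem w hw
    set p := leastPeriod w
    rw [EReal.coe_le_coe_iff]
    have hp0 : (0 : ℝ) < p := by exact_mod_cast hp1
    rw [div_le_iff₀ hp0]
    have M := G.main p 0 (i - 1) (w.length - p) hp1 (by
      intro x hx hx'
      have h1 := hf (x - (i - 1)) (by omega)
      have h2 := hf (x - (i - 1) + p) (by omega)
      have h3 := hp3 (x - (i - 1)) (by omega)
      rw [h1, h2] at h3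
      simp only [hκ]
      rw [show x + 1 = i + (x - (i - 1)) by omega,
        show x + p + 1 = i + (x - (i - 1) + p) by omega]
      exact h3)
    simp only [SS_zero_eq, gg] at M
    push_cast [Nat.cast_sub hp2] at M
    linarith
  · have key : ∀ m : ℕ, (((4 + 2 * √3 / 3 - 2 / (m + 1 : ℝ) : ℝ)) : EReal) ≤
        sSup {x : EReal | ∃ w : List ℕ, w ≠ [] ∧ IsFactor k w ∧
        x = (((w.length : ℝ) / (leastPeriod w : ℝ) : ℝ) : EReal)} := by
      intro m
      obtain ⟨a, q, l, hag, hj⟩ := G.lower m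
      obtain ⟨h1, h2⟩ := hj 0
      simp only [SS_zero_eq, gg, Nat.zero_add] at h1 h2
      have hpos := pz_big m
      have hq : q = (pz m).1 := by omega
      have hl : l = 3 * (pz m).1 + gg m := by omega
      let w : List ℕ := (List.range (l + q)).map fun t => κ (a + t)
      have hlen : w.length = l + q := by simp [w]
      have hget : ∀ j, j < l + q → w.getD j 0 = κ (a + j) := by
        intro j hj
        rw [List.getD_eq_getElem _ _ (by omega)]
        simp [w]
      have hne : w ≠ [] := by
        rw [← List.length_pos_iff]; omega
      have hper : IsPeriod w q := by
        refine ⟨by omega, by omega, fun j hj => ?_⟩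
        rw [hget j (by omega), hget (j + q) (by omega), hag j (by omega)]
        congr 1; omega
      have hle : leastPeriod w ≤ q := Nat.sInf_le hper
      have hlp := (leastPeriod_mem w hne).1
      refine le_trans ?_ (le_sSup ⟨w, hne, ⟨a + 1, by omega, fun j hj => ?_⟩, rfl⟩)
      · rw [EReal.coe_le_coe_iff]
        have hlp' : (0 : ℝ) < leastPeriod w := by exact_mod_cast hlp
        have hle' : (leastPeriod w : ℝ) ≤ q := by exact_mod_cast hle
        have hq0 : (0 : ℝ) < q := lt_of_lt_of_le hlp' hle'
        have hqm : (m + 1 : ℝ) ≤ q := by rw [hq]; exact_mod_cast hpos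
        have s1 : (w.length : ℝ) / q ≤ (w.length : ℝ) / leastPeriod w := by gcongr
        refine le_trans ?_ s1
        have hb := (gg_bounds m).2
        rw [← hq] at hb hl
        have s2 : (2 : ℝ) / q ≤ 2 / (m + 1) := by gcongr
        refine le_trans (sub_le_sub_left s2 _) ?_
        rw [le_div_iff₀ hq0, sub_mul, div_mul_cancel₀ _ hq0.ne', hlen, hl]
        push_cast
        linarith
      · rw [hget j (by omega)]
        simp only [hκ]
        congr 1; omega
    have lim : Filter.Tendsto (fun m : ℕ => (((4 + 2 * √3 / 3 - 2 / (m + 1 : ℝ) : ℝ)) : EReal))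
        Filter.atTop (nhds (((2 * √3 + 12) / 3 : ℝ) : EReal)) := by
      rw [EReal.tendsto_coe]
      have t := (tendsto_one_div_add_atTop_nhds_zero_nat (𝕜 := ℝ)).const_mul 2
      have t2 := t.const_sub (4 + 2 * √3 / 3)
      convert t2 using 2
      · ring
      · ring
    exact le_of_tendsto' lim key
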